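/- Let G be a finite metric graph, let B be a set of vertices of G containing all boundary vertices and all proper core vertices of G, and let λ < λ_G, where λ_G := inf { π²/u_C² : C a cycle in G with commensurate edges }. Then λ is an eigenvalue of −Δ_G if and only if λ is a pole of M_B, and moreover dim ker(−Δ_G − λ) = rank Res_λ M_B. -/

import Mathlib

open Real Set Filter Topology

noncomputable section

/-- A finite metric graph: finite vertex and edge sets, each edge `e` has an initial
vertex `o e`, a terminal vertex `t e` and a positive length `L e`, and is identified
with the interval `[0, L e]`.  Every vertex is an endpoint of some edge. -/
structure MetricGraph where
  V : Type
  E : Type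
  [fintV : Fintype V]
  [fintE : Fintype E]
  [decV : DecidableEq V]
  [decE : DecidableEq E]
  o : E → V
  t : E → V
  L : E → ℝ
  L_pos : ∀ e, 0 < L e
  noIsolated : ∀ v, ∃ e, o e = v ∨ t e = v

attribute [instance] MetricGraph.fintV MetricGraph.fintE MetricGraph.decV MetricGraph.decE

namespace MetricGraph

variable (G : MetricGraph)

/-- The source vertex of edge `e` traversed in direction `d`. -/
def esrc (e : G.E) (d : Bool) : G.V := if d then G.o e else G.t e

/-- The destination vertex of edge `e` traversed in direction `d`. -/
def edst (e : G.E) (d : Bool) : G.V := if d then G.t e else G.o e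

/-- A cycle in a metric graph: a closed walk which uses no edge twice and repeats no
vertex except that its initial and terminal vertices coincide. -/
structure Cycle where
  n : ℕ
  npos : 0 < n
  edge : Fin n → G.E
  dir : Fin n → Bool
  edge_inj : Function.Injective edge
  vert_inj : Function.Injective fun i => G.esrc (edge i) (dir i)
  chain : ∀ i : Fin n,
    G.edst (edge i) (dir i) =
      G.esrc (edge ⟨((i : ℕ) + 1) % n, Nat.mod_lt _ npos⟩)
        (dir ⟨((i : ℕ) + 1) % n, Nat.mod_lt _ npos⟩)

/-- The length of a cycle: the sum of the lengths of its edges. -/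
def Cycle.length {G : MetricGraph} (c : G.Cycle) : ℝ := ∑ i, G.L (c.edge i)

/-- The cycle `c` lies in the subgraph given by the edge set `S`. -/
def Cycle.inSub {G : MetricGraph} (c : G.Cycle) (S : Set G.E) : Prop := ∀ i, c.edge i ∈ S

/-- The cycle `c` has odd length with respect to `x`: its length is an odd multiple of `x`. -/
def Cycle.oddLength {G : MetricGraph} (c : G.Cycle) (x : ℝ) : Prop :=
  ∃ m : ℕ, Odd m ∧ c.length = m * x

/-- The initial vertex of a cycle. -/
def Cycle.start {G : MetricGraph} (c : G.Cycle) : G.V :=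
  G.esrc (c.edge ⟨0, c.npos⟩) (c.dir ⟨0, c.npos⟩)

/-- The vertices incident to an edge of the edge set `S`, i.e. the vertex set of the
subgraph generated by `S`. -/
def incVerts (S : Set G.E) : Set G.V := {v | ∃ e ∈ S, G.o e = v ∨ G.t e = v}

/-- Two vertices are related iff they are connected through edges of `S`. -/
def connRel (S : Set G.E) : G.V → G.V → Prop :=
  Relation.EqvGen fun v w => ∃ e ∈ S, G.o e = v ∧ G.t e = w

/-- The connected component of the vertex `v` in the subgraph given by `S`. -/
def component (S : Set G.E) (v : G.V) : Set G.V := {w | G.connRel S v w}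

/-- The number of connected components of the subgraph given by the edge set `S`. -/
def beta0 (S : Set G.E) : ℕ := (G.component S '' G.incVerts S).ncard

/-- The first Betti number `|E| - |V| + β₀` of the subgraph given by the edge set `S`. -/
def beta1 (S : Set G.E) : ℤ :=
  (S.ncard : ℤ) - ((G.incVerts S).ncard : ℤ) + (G.beta0 S : ℤ)

/-- The number of connected components of the subgraph given by `S` which contain a
cycle of odd length with respect to `x`. -/
def beta0odd (S : Set G.E) (x : ℝ) : ℕ :=
  (G.component S '' {v | v ∈ G.incVerts S ∧
    ∃ c : G.Cycle, c.inSub S ∧ c.oddLength x ∧ G.connRel S v c.start}).ncard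

/-- The edge set of the subgraph `G_λ`: all edges whose length is a positive integer
multiple of `π / √λ`. -/
def lamEdges (lam : ℝ) : Set G.E :=
  {e | ∃ k : ℕ, 0 < k ∧ G.L e = k * (π / Real.sqrt lam)}

/-- An edgewise given function is continuous at all the vertices of `G`. -/
def ContVert (f : G.E → ℝ → ℂ) : Prop :=
  (∀ e₁ e₂, G.o e₁ = G.o e₂ → f e₁ 0 = f e₂ 0) ∧
  (∀ e₁ e₂, G.o e₁ = G.t e₂ → f e₁ 0 = f e₂ (G.L e₂)) ∧
  (∀ e₁ e₂, G.t e₁ = G.t e₂ → f e₁ (G.L e₁) = f e₂ (G.L e₂))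

/-- The value of an (edgewise given, vertex-continuous) function at the vertex `v`. -/
def vtxVal (f : G.E → ℝ → ℂ) (v : G.V) : ℂ :=
  if h : ∃ e, G.o e = v then f h.choose 0
  else f (G.noIsolated v).choose (G.L ((G.noIsolated v).choose))

/-- `∂_ν f (v)`: the sum of the derivatives at the vertex `v` of the restrictions of
`f` to the edges incident to `v`, all pointing towards `v`. -/
def normDer (f : G.E → ℝ → ℂ) (v : G.V) : ℂ :=
  (∑ e ∈ Finset.univ.filter fun e => G.t e = v, deriv (f e) (G.L e)) -
    ∑ e ∈ Finset.univ.filter fun e => G.o e = v, deriv (f e) 0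

/-- `f` solves `-f'' = μ f` on every edge and is continuous at the vertices.
(A solution of `-f'' = μ f` on `[0, L e]` is identified with its unique extension to a
global solution on `ℝ`.) -/
def IsSol (mu : ℂ) (f : G.E → ℝ → ℂ) : Prop :=
  (∀ e, ContDiff ℝ 2 (f e)) ∧
  (∀ e, ∀ x : ℝ, deriv (deriv (f e)) x = -mu * f e x) ∧ G.ContVert f

/-- Membership in `ker (-Δ_G - λ)` for the Kirchhoff Laplacian `-Δ_G`. -/
def InKer (lam : ℝ) (f : G.E → ℝ → ℂ) : Prop :=
  G.IsSol (lam : ℂ) f ∧ ∀ v, G.normDer f v = 0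

/-- `ker (-Δ_G - λ)` as a set of (edgewise given) functions. -/
def kerSet (lam : ℝ) : Set (G.E → ℝ → ℂ) := {f | G.InKer lam f}

/-- `λ` is an eigenvalue of the Kirchhoff Laplacian `-Δ_G`. -/
def IsEigenvalue (lam : ℝ) : Prop := G.kerSet lam ≠ {0}

/-- `dim ker (-Δ_G - λ)`. -/
def dimKer (lam : ℝ) : ℕ := Module.finrank ℂ (Submodule.span ℂ (G.kerSet lam))

/-- The resonance eigenspace `R (G, λ)`: all elements of `ker (-Δ_G - λ)` vanishing at
every vertex of `G`. -/
def resSet (lam : ℝ) : Set (G.E → ℝ → ℂ) :=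
  {f | G.InKer lam f ∧ ∀ e, f e 0 = 0 ∧ f e (G.L e) = 0}

/-- `λ` is a (real) resonance of `G` iff `R (G, λ) ≠ {0}`. -/
def IsResonance (lam : ℝ) : Prop := G.resSet lam ≠ {0}

/-- `dim R (G, λ)`. -/
def dimRes (lam : ℝ) : ℕ := Module.finrank ℂ (Submodule.span ℂ (G.resSet lam))

/-- `R_B (G, λ)`: all elements of `ker (-Δ_G - λ)` vanishing at every vertex in `B`. -/
def resSetB (B : Set G.V) (lam : ℝ) : Set (G.E → ℝ → ℂ) :=
  {f | G.InKer lam f ∧ ∀ e, (G.o e ∈ B → f e 0 = 0) ∧ (G.t e ∈ B → f e (G.L e) = 0)}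

/-- `dim R_B (G, λ)`. -/
def dimResB (B : Set G.V) (lam : ℝ) : ℕ :=
  Module.finrank ℂ (Submodule.span ℂ (G.resSetB B lam))

/-- The degree of a vertex (a loop counts twice). -/
def degree (v : G.V) : ℕ := {e | G.o e = v}.ncard + {e | G.t e = v}.ncard

/-- The degree of a vertex inside the subgraph given by the edge set `S`. -/
def degreeIn (S : Set G.E) (v : G.V) : ℕ :=
  {e | e ∈ S ∧ G.o e = v}.ncard + {e | e ∈ S ∧ G.t e = v}.ncard

/-- The edge set of the core of `G`: the largest subgraph without vertices of degree one. -/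
def coreEdges : Set G.E := ⋃₀ {S : Set G.E | ∀ v, G.degreeIn S v ≠ 1}

/-- A boundary vertex is a vertex of degree one. -/
def IsBoundaryVertex (v : G.V) : Prop := G.degree v = 1

/-- A proper core vertex: all edges attached to it belong to the core of `G`. -/
def IsProperCoreVertex (v : G.V) : Prop :=
  ∀ e, G.o e = v ∨ G.t e = v → e ∈ G.coreEdges

/-- The defining property of the function `f^{(l)}` for the Titchmarsh--Weyl matrix:
`f` solves `-f'' = μ f` edgewise, is continuous at the vertices, and satisfies
`∂_ν f (v₀) = 1` and `∂_ν f (v) = 0` for all vertices `v ≠ v₀`. -/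
def IsTWsol (mu : ℂ) (v0 : G.V) (f : G.E → ℝ → ℂ) : Prop :=
  G.IsSol mu f ∧ G.normDer f v0 = 1 ∧ ∀ v, v ≠ v0 → G.normDer f v = 0

open scoped Classical in
/-- The Titchmarsh--Weyl matrix `M_B (μ)` with entries `(M_B (μ))_{k,l} = f^{(l)} (v_k)`
(defined via choice; junk if no `f^{(l)}` exists, i.e. at the eigenvalues). -/
def TW (B : Finset G.V) (mu : ℂ) : Matrix B B ℂ :=
  Matrix.of fun k l : B => if h : ∃ f, G.IsTWsol mu l f then G.vtxVal h.choose k else 0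

/-- The cycle `c` has commensurate edges: all ratios of edge lengths are rational. -/
def Commensurate (c : G.Cycle) : Prop :=
  ∀ i j, ∃ q : ℚ, G.L (c.edge i) = q * G.L (c.edge j)

/-- `u_C`: the maximal number such that the length of each edge of the cycle `c` is a
positive integer multiple of it. -/
def uC (c : G.Cycle) : ℝ :=
  sSup {u : ℝ | 0 < u ∧ ∀ i, ∃ k : ℕ, 0 < k ∧ G.L (c.edge i) = k * u}

/-- `λ_G := inf { π²/u_C² : C a cycle in G with commensurate edges }`, with value `+∞`
if there is no cycle with commensurate edges. -/
def lamThreshold : EReal :=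
  sInf {x : EReal | ∃ c : G.Cycle, G.Commensurate c ∧ x = ((π ^ 2 / (G.uC c) ^ 2 : ℝ) : EReal)}

end MetricGraph

section MatrixFun

variable {m : Type} [Fintype m]

/-- The matrix function `M` has a pole of order `n` at `λ`:
`lim_{z → λ} (z - λ)^n M(z)` exists and is nonzero, while
`lim_{z → λ} (z - λ)^(n+1) M(z) = 0`. -/
def hasPoleOrder (M : ℂ → Matrix m m ℂ) (lam : ℂ) (n : ℕ) : Prop :=
  (∃ A : Matrix m m ℂ, A ≠ 0 ∧
    Filter.Tendsto (fun z => (z - lam) ^ n • M z) (𝓝[≠] lam) (𝓝 A)) ∧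
  Filter.Tendsto (fun z => (z - lam) ^ (n + 1) • M z) (𝓝[≠] lam) (𝓝 0)

/-- `λ` is a pole of the matrix function `M`: `M` is analytic on a punctured
neighborhood of `λ` and has a pole of some order `n ≥ 1` at `λ`. -/
def isPole (M : ℂ → Matrix m m ℂ) (lam : ℂ) : Prop :=
  (∀ᶠ z in 𝓝[≠] lam, ∀ k l, AnalyticAt ℂ (fun w => M w k l) z) ∧
  ∃ n : ℕ, 1 ≤ n ∧ hasPoleOrder M lam n

open scoped Classical in
/-- `Res_λ M := (2πi)⁻¹ ∮_Γ M(μ) dμ`, computed entrywise over a sufficiently small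
positively oriented circle `Γ` centered at `λ` (defined via choice as the common value
of the circle integrals over all sufficiently small radii). -/
def matResidue (M : ℂ → Matrix m m ℂ) (lam : ℂ) : Matrix m m ℂ :=
  Matrix.of fun k l =>
    if h : ∃ c : ℂ, ∀ᶠ R in 𝓝[>] (0 : ℝ),
        (2 * (π : ℂ) * Complex.I)⁻¹ * circleIntegral (fun z => M z k l) lam R = c
    then h.choose else 0

end MatrixFun


/-- The generator of the first order system associated with `-f'' = μ f`. -/
def odeGen (mu : ℂ) : ℂ × ℂ →L[ℂ] ℂ × ℂ :=
  (ContinuousLinearMap.snd ℂ ℂ ℂ).prod (-mu • ContinuousLinearMap.fst ℂ ℂ ℂ)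

/-- The flow of `-f'' = μ f`: it maps `(f 0, f' 0)` to `(f x, f' x)`. -/
def odeFlow (mu : ℂ) (x : ℝ) : ℂ × ℂ →L[ℂ] ℂ × ℂ := NormedSpace.exp (x • odeGen mu)

lemma odeFlow_zero (mu : ℂ) (v : ℂ × ℂ) : odeFlow mu 0 v = v := by
  have : (0 : ℝ) • odeGen mu = 0 := by ext <;> simp
  rw [odeFlow, this, NormedSpace.exp_zero]
  rfl

lemma hasDerivAt_odeFlow (mu : ℂ) (v : ℂ × ℂ) (x : ℝ) :
    HasDerivAt (fun y => odeFlow mu y v) (odeGen mu (odeFlow mu x v)) x := by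
  have h := hasDerivAt_exp_smul_const' (𝕂 := ℝ) (odeGen mu) x
  exact ((ContinuousLinearMap.apply ℂ (ℂ × ℂ) v).restrictScalars ℝ).hasFDerivAt.comp_hasDerivAt x h

lemma hasDerivAt_odeFlow_fst (mu : ℂ) (v : ℂ × ℂ) (x : ℝ) :
    HasDerivAt (fun y => (odeFlow mu y v).1) (odeFlow mu x v).2 x :=
  (hasDerivAt_odeFlow mu v x).fst

lemma hasDerivAt_odeFlow_snd (mu : ℂ) (v : ℂ × ℂ) (x : ℝ) :
    HasDerivAt (fun y => (odeFlow mu y v).2) (-mu * (odeFlow mu x v).1) x :=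
  (hasDerivAt_odeFlow mu v x).snd

lemma analyticAt_odeFlow (x : ℝ) (mu : ℂ) : AnalyticAt ℂ (fun z => odeFlow z x) mu := by
  have h : AnalyticAt ℂ (fun z => x • odeGen z) mu := by
    have : (fun z => x • odeGen z) = fun z : ℂ =>
        x • (ContinuousLinearMap.snd ℂ ℂ ℂ).prod (0 : ℂ × ℂ →L[ℂ] ℂ)
        + z • (x • (0 : ℂ × ℂ →L[ℂ] ℂ).prod (-ContinuousLinearMap.fst ℂ ℂ ℂ)) := by
      funext z
      ext <;> simp [odeGen, mul_comm]
    rw [this]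
    exact analyticAt_const.add (analyticAt_id.smul analyticAt_const)
  exact AnalyticAt.fun_comp (NormedSpace.exp_analytic (𝕂 := ℂ) (x • odeGen mu)) h

lemma continuous_odeFlow : Continuous fun p : ℂ × ℝ => odeFlow p.1 p.2 := by
  let _ : NormedAlgebra ℚ (ℂ × ℂ →L[ℂ] ℂ × ℂ) := NormedAlgebra.restrictScalars ℚ ℝ _
  refine NormedSpace.exp_continuous.comp ?_
  have : (fun p : ℂ × ℝ => p.2 • odeGen p.1) = fun p : ℂ × ℝ =>
        p.2 • (ContinuousLinearMap.snd ℂ ℂ ℂ).prod (0 : ℂ × ℂ →L[ℂ] ℂ)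
        + p.1 • (p.2 • (0 : ℂ × ℂ →L[ℂ] ℂ).prod (-ContinuousLinearMap.fst ℂ ℂ ℂ)) := by
    funext z
    ext <;> simp [odeGen, mul_comm]
  rw [this]
  fun_prop

lemma ode_unique {mu : ℂ} {u w : ℝ → ℂ × ℂ} (hu : ∀ x, HasDerivAt u (odeGen mu (u x)) x)
    (hw : ∀ x, HasDerivAt w (odeGen mu (w x)) x) {x₀ : ℝ} (h : u x₀ = w x₀) : u = w :=
  ODE_solution_unique_univ (v := fun _ => odeGen mu) (s := fun _ => univ)
    (fun _ => (odeGen mu).lipschitz.lipschitzOnWith) (fun x => ⟨hu x, mem_univ _⟩)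
    (fun x => ⟨hw x, mem_univ _⟩) h

lemma eq_odeFlow {mu : ℂ} {f f' : ℝ → ℂ} (h₁ : ∀ x, HasDerivAt f (f' x) x)
    (h₂ : ∀ x, HasDerivAt f' (-mu * f x) x) (x : ℝ) :
    (f x, f' x) = odeFlow mu x (f 0, f' 0) :=
  congrFun (ode_unique (u := fun x => (f x, f' x)) (fun x => (h₁ x).prodMk (h₂ x))
    (hasDerivAt_odeFlow mu _) (x₀ := 0) (odeFlow_zero _ _).symm) x

lemma odeFlow_injective {mu : ℂ} {x : ℝ} {v : ℂ × ℂ} (h : odeFlow mu x v = 0) : v = 0 := by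
  have := ode_unique (hasDerivAt_odeFlow mu v) (w := fun _ => 0)
    (fun y => by simpa using hasDerivAt_const y (0 : ℂ × ℂ)) h
  simpa [odeFlow_zero] using congrFun this 0

open ComplexConjugate in
lemma odeFlow_conj (mu : ℂ) (x : ℝ) (v : ℂ × ℂ) :
    odeFlow (conj mu) x (conj v.1, conj v.2)
      = (conj (odeFlow mu x v).1, conj (odeFlow mu x v).2) := by
  have h := eq_odeFlow (mu := conj mu) (f := fun x => conj (odeFlow mu x v).1)
    (f' := fun x => conj (odeFlow mu x v).2)
    (fun x => (hasDerivAt_odeFlow_fst mu v x).star)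
    (fun x => by simpa using (hasDerivAt_odeFlow_snd mu v x).star) x
  simp only [odeFlow_zero] at h
  exact h.symm

/-- Vanishing at both endpoints forces `x` to be a multiple of `π / √λ`. -/
lemma exists_nat_of_odeFlow_eq_zero {lam L : ℝ} (hL : 0 < L) {b : ℂ} (hb : b ≠ 0)
    (h : (odeFlow lam L (0, b)).1 = 0) :
    0 < lam ∧ ∃ k : ℕ, 0 < k ∧ L = k * (π / √lam) := by
  obtain ⟨s, hs⟩ := IsAlgClosed.exists_pow_nat_eq (lam : ℂ) (n := 2) two_pos
  by_cases h0 : s = 0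
  · have := eq_odeFlow (mu := lam) (f := fun x => b * x) (f' := fun _ => b)
      (fun x => by simpa using (Complex.ofRealCLM.hasDerivAt (x := x)).const_mul b)
      (fun x => by simpa [← hs, h0] using hasDerivAt_const x b) L
    simp only [Complex.ofReal_zero, mul_zero] at this
    rw [← this] at h
    simp [hb, hL.ne'] at h
  · have := eq_odeFlow (mu := lam) (f := fun x => b * (Complex.sin (s * x) / s))
      (f' := fun x => b * Complex.cos (s * x))
      (fun x => by
        have h1 : HasDerivAt (fun x : ℝ => s * (x : ℂ)) s x := by
          simpa using (Complex.ofRealCLM.hasDerivAt (x := x)).const_mul s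
        have := (((Complex.hasDerivAt_sin (s * x)).comp x h1).div_const s).const_mul b
        refine this.congr_deriv ?_
        field_simp)
      (fun x => by
        have h1 : HasDerivAt (fun x : ℝ => s * (x : ℂ)) s x := by
          simpa using (Complex.ofRealCLM.hasDerivAt (x := x)).const_mul s
        have := ((Complex.hasDerivAt_cos (s * x)).comp x h1).const_mul b
        refine this.congr_deriv ?_
        rw [← hs]
        field_simp) L
    simp only [Complex.ofReal_zero, mul_zero, Complex.sin_zero, zero_div, Complex.cos_zero,
      mul_one] at this
    rw [← this] at h
    simp only [mul_eq_zero, hb, div_eq_zero_iff, h0, or_false, false_or] at h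
    obtain ⟨k, hk⟩ := Complex.sin_eq_zero_iff.1 h
    have hLc : (L : ℂ) ≠ 0 := by exact_mod_cast hL.ne'
    have hlam : lam = (k * π / L) ^ 2 := by
      have : s = k * π / L := by rw [← hk]; field_simp
      rw [this] at hs
      exact_mod_cast hs.symm
    have hk0 : k ≠ 0 := by
      rintro rfl
      simp [h0, hLc] at hk
    have hkR : (k : ℝ) ≠ 0 := by exact_mod_cast hk0
    have hpos : (k : ℝ) * π / L ≠ 0 := by positivity
    refine ⟨hlam ▸ by positivity, k.natAbs, Int.natAbs_pos.2 hk0, ?_⟩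
    rw [hlam, Real.sqrt_sq_eq_abs, abs_div, abs_mul, abs_of_pos pi_pos, abs_of_pos hL,
      Nat.cast_natAbs, Int.cast_abs]
    field_simp

namespace MetricGraph

variable {G : MetricGraph}

/-- The initial data `(f 0, f' 0)` on the edge `e` encoded by `p`, which lists the vertex
values and the initial slopes of a function. -/
def initData (p : G.V ⊕ G.E → ℂ) (e : G.E) : ℂ × ℂ := (p (.inl (G.o e)), p (.inr e))

/-- The edgewise solution of `-f'' = μ f` with initial data `p`. -/
def solOf (mu : ℂ) (p : G.V ⊕ G.E → ℂ) (e : G.E) (x : ℝ) : ℂ := (odeFlow mu x (initData p e)).1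

lemma initData_add (p q : G.V ⊕ G.E → ℂ) (e : G.E) :
    initData (p + q) e = initData p e + initData q e := rfl

lemma initData_smul (c : ℂ) (p : G.V ⊕ G.E → ℂ) (e : G.E) :
    initData (c • p) e = c • initData p e := rfl

/-- The square linear system for the data `p`: the vertex components are the normal derivatives
of `solOf μ p`, the edge components are the defects of continuity at the terminal vertices. -/
def vertexSystem (G : MetricGraph) (mu : ℂ) : (G.V ⊕ G.E → ℂ) →ₗ[ℂ] (G.V ⊕ G.E → ℂ) where
  toFun p := Sum.elim
    (fun v => (∑ e ∈ Finset.univ.filter fun e => G.t e = v,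
        (odeFlow mu (G.L e) (initData p e)).2) -
      ∑ e ∈ Finset.univ.filter fun e => G.o e = v, p (.inr e))
    (fun e => (odeFlow mu (G.L e) (initData p e)).1 - p (.inl (G.t e)))
  map_add' p q := by
    ext (v | e)
    · simp only [initData_add, map_add, Prod.snd_add, Pi.add_apply, Finset.sum_add_distrib,
        Sum.elim_inl]
      ring
    · simp only [initData_add, map_add, Prod.fst_add, Pi.add_apply, Sum.elim_inr]
      ring
  map_smul' c p := by
    ext (v | e)
    · simp only [initData_smul, map_smul, Prod.smul_snd, Pi.smul_apply, Sum.elim_inl, smul_eq_mul,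
        RingHom.id_apply, mul_sub, Finset.mul_sum]
    · simp only [initData_smul, map_smul, Prod.smul_fst, Pi.smul_apply, Sum.elim_inr, smul_eq_mul,
        RingHom.id_apply]
      ring

lemma vertexSystem_inl (mu : ℂ) (p : G.V ⊕ G.E → ℂ) (v : G.V) :
    G.vertexSystem mu p (.inl v) = (∑ e ∈ Finset.univ.filter fun e => G.t e = v,
        (odeFlow mu (G.L e) (initData p e)).2) -
      ∑ e ∈ Finset.univ.filter fun e => G.o e = v, p (.inr e) := rfl

lemma vertexSystem_inr (mu : ℂ) (p : G.V ⊕ G.E → ℂ) (e : G.E) :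
    G.vertexSystem mu p (.inr e) = (odeFlow mu (G.L e) (initData p e)).1 - p (.inl (G.t e)) := rfl

/-- The data `p` describe a function which is continuous at the vertices. -/
def IsContData (mu : ℂ) (p : G.V ⊕ G.E → ℂ) : Prop := ∀ e, G.vertexSystem mu p (.inr e) = 0

lemma deriv_solOf (mu : ℂ) (p : G.V ⊕ G.E → ℂ) (e : G.E) (x : ℝ) :
    deriv (solOf mu p e) x = (odeFlow mu x (initData p e)).2 :=
  (hasDerivAt_odeFlow_fst mu _ x).deriv

lemma solOf_zero (mu : ℂ) (p : G.V ⊕ G.E → ℂ) (e : G.E) : solOf mu p e 0 = p (.inl (G.o e)) := by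
  simp [solOf, odeFlow_zero, initData]

lemma IsContData.solOf_length {mu : ℂ} {p : G.V ⊕ G.E → ℂ} (hp : IsContData mu p) (e : G.E) :
    solOf mu p e (G.L e) = p (.inl (G.t e)) :=
  sub_eq_zero.1 (hp e)

lemma IsContData.isSol {mu : ℂ} {p : G.V ⊕ G.E → ℂ} (hp : IsContData mu p) :
    G.IsSol mu (solOf mu p) := by
  have hd : ∀ e, deriv (solOf mu p e) = fun x => (odeFlow mu x (initData p e)).2 :=
    fun e => funext (deriv_solOf mu p e)
  have hdd : ∀ e x, deriv (deriv (solOf mu p e)) x = -mu * solOf mu p e x := fun e x => by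
    rw [hd]
    exact (hasDerivAt_odeFlow_snd mu _ x).deriv
  refine ⟨fun e => ?_, hdd, fun e₁ e₂ h => ?_, fun e₁ e₂ h => ?_, fun e₁ e₂ h => ?_⟩
  · have h0 : Differentiable ℝ (solOf mu p e) := fun x =>
      (hasDerivAt_odeFlow_fst mu (initData p e) x).differentiableAt
    have h1 : Differentiable ℝ (deriv (solOf mu p e)) := by
      rw [hd]
      exact fun x => (hasDerivAt_odeFlow_snd mu (initData p e) x).differentiableAt
    rw [show (2 : WithTop ℕ∞) = 1 + 1 by norm_num, contDiff_succ_iff_deriv]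
    refine ⟨h0, by simp, contDiff_one_iff_deriv.2 ⟨h1, ?_⟩⟩
    rw [funext (hdd e)]
    exact continuous_const.mul h0.continuous
  · rw [solOf_zero, solOf_zero, h]
  · rw [solOf_zero, hp.solOf_length, h]
  · rw [hp.solOf_length, hp.solOf_length, h]

lemma normDer_solOf (mu : ℂ) (p : G.V ⊕ G.E → ℂ) (v : G.V) :
    G.normDer (solOf mu p) v = G.vertexSystem mu p (.inl v) := by
  simp [normDer, vertexSystem_inl, deriv_solOf, odeFlow_zero, initData]

lemma vtxVal_o {f : G.E → ℝ → ℂ} (hf : G.ContVert f) (e : G.E) :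
    G.vtxVal f (G.o e) = f e 0 := by
  have h : ∃ e', G.o e' = G.o e := ⟨e, rfl⟩
  rw [vtxVal, dif_pos h]
  exact hf.1 _ _ h.choose_spec

lemma vtxVal_t {f : G.E → ℝ → ℂ} (hf : G.ContVert f) (e : G.E) :
    G.vtxVal f (G.t e) = f e (G.L e) := by
  rw [vtxVal]
  split_ifs with h
  · exact hf.2.1 _ _ h.choose_spec
  · exact hf.2.2 _ _ ((G.noIsolated (G.t e)).choose_spec.resolve_left fun h' => h ⟨_, h'⟩)

lemma IsContData.vtxVal_solOf {mu : ℂ} {p : G.V ⊕ G.E → ℂ} (hp : IsContData mu p) (v : G.V) :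
    G.vtxVal (solOf mu p) v = p (.inl v) := by
  obtain ⟨e, rfl | rfl⟩ := G.noIsolated v
  · rw [vtxVal_o hp.isSol.2.2, solOf_zero]
  · rw [vtxVal_t hp.isSol.2.2, hp.solOf_length]

lemma IsContData.ext_solOf {mu : ℂ} {p q : G.V ⊕ G.E → ℂ} (hp : IsContData mu p)
    (hq : IsContData mu q) (h : solOf mu p = solOf mu q) : p = q := by
  ext (v | e)
  · rw [← hp.vtxVal_solOf, ← hq.vtxVal_solOf, h]
  · have := deriv_solOf mu p e 0
    rw [h, deriv_solOf] at this
    simpa [odeFlow_zero, initData] using this.symm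

lemma IsSol.exists_eq_solOf {mu : ℂ} {f : G.E → ℝ → ℂ} (hf : G.IsSol mu f) :
    ∃ p, IsContData mu p ∧ f = solOf mu p := by
  let p : G.V ⊕ G.E → ℂ := Sum.elim (G.vtxVal f) fun e => deriv (f e) 0
  have h : f = solOf mu p := by
    ext e x
    have h0 : ∀ x, HasDerivAt (f e) (deriv (f e) x) x := fun x =>
      ((hf.1 e).differentiable (by norm_num) x).hasDerivAt
    have h1 : ∀ x, HasDerivAt (deriv (f e)) (-mu * f e x) x := fun x => by
      rw [← hf.2.1]
      refine DifferentiableAt.hasDerivAt ?_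
      have := hf.1 e
      rw [show (2 : WithTop ℕ∞) = 1 + 1 by norm_num, contDiff_succ_iff_deriv] at this
      exact this.2.2.differentiable (by norm_num) x
    have := congrArg Prod.fst (eq_odeFlow h0 h1 x)
    rw [← vtxVal_o hf.2.2] at this
    exact this
  refine ⟨p, fun e => sub_eq_zero.2 ?_, h⟩
  change solOf mu p e (G.L e) = G.vtxVal f (G.t e)
  rw [← h, vtxVal_t hf.2.2]

lemma isTWsol_iff {mu : ℂ} {v : G.V} {f : G.E → ℝ → ℂ} :
    G.IsTWsol mu v f ↔
      ∃ p, G.vertexSystem mu p = Pi.single (.inl v) 1 ∧ f = solOf mu p := by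
  constructor
  · rintro ⟨hf, h1, h0⟩
    obtain ⟨p, hp, rfl⟩ := hf.exists_eq_solOf
    refine ⟨p, ?_, rfl⟩
    ext (w | e)
    · by_cases hw : w = v
      · subst hw
        simpa [normDer_solOf] using h1
      · rw [← normDer_solOf, h0 w hw, Pi.single_eq_of_ne (by simpa using hw)]
    · rw [hp e, Pi.single_eq_of_ne (by simp)]
  · rintro ⟨p, hp, rfl⟩
    have hc : IsContData mu p := fun e => by rw [hp, Pi.single_eq_of_ne (by simp)]
    refine ⟨hc.isSol, by simp [normDer_solOf, hp], fun w hw => ?_⟩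
    rw [normDer_solOf, hp, Pi.single_eq_of_ne (by simpa using hw)]

lemma inKer_iff {lam : ℝ} {f : G.E → ℝ → ℂ} :
    G.InKer lam f ↔ ∃ p, G.vertexSystem lam p = 0 ∧ f = solOf lam p := by
  constructor
  · rintro ⟨hf, h0⟩
    obtain ⟨p, hp, rfl⟩ := hf.exists_eq_solOf
    refine ⟨p, ?_, rfl⟩
    ext (w | e)
    · rw [← normDer_solOf, h0 w, Pi.zero_apply]
    · exact hp e
  · rintro ⟨p, hp, rfl⟩
    have hc : IsContData lam p := fun e => by rw [hp, Pi.zero_apply]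
    exact ⟨hc.isSol, fun w => by rw [normDer_solOf, hp, Pi.zero_apply]⟩

/-- The solution with given data, as a linear map. -/
def solOfLin (G : MetricGraph) (mu : ℂ) : (G.V ⊕ G.E → ℂ) →ₗ[ℂ] (G.E → ℝ → ℂ) where
  toFun := solOf mu
  map_add' p q := by
    ext e x
    simp [solOf, initData_add]
  map_smul' c p := by
    ext e x
    simp [solOf, initData_smul]

lemma coe_range_solOfLin (lam : ℝ) :
    G.kerSet lam =
      ((G.solOfLin lam).comp (LinearMap.ker (G.vertexSystem lam)).subtype).range := by
  ext f
  simp only [kerSet, mem_ofPred_eq, inKer_iff]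
  constructor
  · rintro ⟨p, hp, rfl⟩
    exact ⟨⟨p, hp⟩, rfl⟩
  · rintro ⟨⟨p, hp⟩, rfl⟩
    exact ⟨p, hp, rfl⟩

lemma dimKer_eq (lam : ℝ) :
    G.dimKer lam = Module.finrank ℂ (LinearMap.ker (G.vertexSystem lam)) := by
  rw [dimKer, coe_range_solOfLin, Submodule.span_eq, LinearMap.finrank_range_of_inj]
  rintro ⟨p, hp⟩ ⟨q, hq⟩ h
  have hp' : IsContData (lam : ℂ) p := fun e => congrFun hp _
  have hq' : IsContData (lam : ℂ) q := fun e => congrFun hq _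
  exact Subtype.ext (hp'.ext_solOf hq' h)

lemma isEigenvalue_iff (lam : ℝ) : G.IsEigenvalue lam ↔ G.dimKer lam ≠ 0 := by
  rw [IsEigenvalue, dimKer_eq, not_iff_not, Submodule.finrank_eq_zero]
  constructor
  · intro h
    refine (Submodule.eq_bot_iff _).2 fun p hp => ?_
    have hp' : IsContData (lam : ℂ) p := fun e => congrFun hp _
    have h0 : solOf (lam : ℂ) p = 0 := by
      have : solOf (lam : ℂ) p ∈ G.kerSet lam := inKer_iff.2 ⟨p, hp, rfl⟩
      rwa [h] at this
    have hz : IsContData (lam : ℂ) (0 : G.V ⊕ G.E → ℂ) := fun e => by simp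
    exact hp'.ext_solOf hz (h0.trans (map_zero (G.solOfLin lam)).symm)
  · intro h
    ext f
    simp only [kerSet, mem_ofPred_eq, inKer_iff, mem_singleton_iff]
    constructor
    · rintro ⟨p, hp, rfl⟩
      have : p = 0 := by simpa [h] using (show p ∈ LinearMap.ker (G.vertexSystem lam) from hp)
      exact this ▸ map_zero (G.solOfLin lam)
    · rintro rfl
      exact ⟨0, map_zero _, (map_zero (G.solOfLin lam)).symm⟩

end MetricGraph

namespace MetricGraph

variable {G : MetricGraph}

/-- The bilinear pairing of two edgewise solutions in `L²(G)`. -/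
def pairing (mu nu : ℂ) (p q : G.V ⊕ G.E → ℂ) : ℂ :=
  ∑ e, ∫ x in (0 : ℝ)..G.L e, solOf mu p e x * solOf nu q e x

lemma continuous_solOf (mu : ℂ) (p : G.V ⊕ G.E → ℂ) (e : G.E) : Continuous (solOf mu p e) :=
  Differentiable.continuous (𝕜 := ℝ) fun x => (hasDerivAt_odeFlow_fst mu _ x).differentiableAt

lemma green_edge (mu nu : ℂ) (p q : G.V ⊕ G.E → ℂ) (e : G.E) :
    (nu - mu) * ∫ x in (0 : ℝ)..G.L e, solOf mu p e x * solOf nu q e x =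
      ((odeFlow mu (G.L e) (initData p e)).2 * solOf nu q e (G.L e)
        - solOf mu p e (G.L e) * (odeFlow nu (G.L e) (initData q e)).2)
      - (p (.inr e) * q (.inl (G.o e)) - p (.inl (G.o e)) * q (.inr e)) := by
  rw [← intervalIntegral.integral_const_mul]
  have hd : ∀ x ∈ uIcc 0 (G.L e), HasDerivAt (fun x =>
      (odeFlow mu x (initData p e)).2 * solOf nu q e x
        - solOf mu p e x * (odeFlow nu x (initData q e)).2)
      ((nu - mu) * (solOf mu p e x * solOf nu q e x)) x := fun x _ => by
    have h1 := (hasDerivAt_odeFlow_snd mu (initData p e) x).mul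
      (hasDerivAt_odeFlow_fst nu (initData q e) x)
    have h2 := (hasDerivAt_odeFlow_fst mu (initData p e) x).mul
      (hasDerivAt_odeFlow_snd nu (initData q e) x)
    refine (h1.sub h2).congr_deriv ?_
    simp only [solOf]
    ring
  rw [intervalIntegral.integral_eq_sub_of_hasDerivAt hd]
  · simp [odeFlow_zero, initData, solOf_zero]
  · exact (continuous_const.mul
      ((continuous_solOf mu p e).mul (continuous_solOf nu q e))).intervalIntegrable _ _

/-- Green's identity. -/
lemma green {mu nu : ℂ} {p q : G.V ⊕ G.E → ℂ} (hp : IsContData mu p) (hq : IsContData nu q) :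
    (nu - mu) * pairing mu nu p q =
      ∑ v, (G.vertexSystem mu p (.inl v) * q (.inl v)
        - p (.inl v) * G.vertexSystem nu q (.inl v)) := by
  have key : ∀ (s : G.E → G.V) (F : G.E → ℂ) (g : G.V → ℂ),
      ∑ v, (∑ e ∈ Finset.univ.filter fun e => s e = v, F e) * g v = ∑ e, F e * g (s e) := by
    intro s F g
    rw [← Finset.sum_fiberwise Finset.univ s]
    refine Finset.sum_congr rfl fun v _ => ?_
    rw [Finset.sum_mul]
    refine Finset.sum_congr rfl fun e he => ?_
    rw [(Finset.mem_filter.1 he).2]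
  have key' : ∀ (s : G.E → G.V) (F : G.E → ℂ) (g : G.V → ℂ),
      ∑ v, g v * (∑ e ∈ Finset.univ.filter fun e => s e = v, F e) = ∑ e, g (s e) * F e := by
    intro s F g
    simpa only [mul_comm] using key s F g
  simp only [vertexSystem_inl, sub_mul, mul_sub, Finset.sum_sub_distrib, key, key']
  rw [pairing, ← sub_mul, Finset.mul_sum]
  simp only [green_edge, hp.solOf_length, hq.solOf_length, Finset.sum_sub_distrib]
  ring

open ComplexConjugate in
lemma vertexSystem_conj (mu : ℂ) (p : G.V ⊕ G.E → ℂ) :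
    G.vertexSystem (conj mu) (fun i => conj (p i)) = fun i => conj (G.vertexSystem mu p i) := by
  have h : ∀ e, initData (fun i => conj (p i)) e
      = (conj (initData p e).1, conj (initData p e).2) := fun e => rfl
  ext (v | e)
  · simp only [vertexSystem_inl, h, odeFlow_conj, map_sub, map_sum]
  · simp only [vertexSystem_inr, h, odeFlow_conj, map_sub]

open ComplexConjugate in
lemma pairing_conj (mu : ℂ) (p : G.V ⊕ G.E → ℂ) :
    pairing mu (conj mu) p (fun i => conj (p i)) =
      ((∑ e, ∫ x in (0 : ℝ)..G.L e, ‖solOf mu p e x‖ ^ 2 : ℝ) : ℂ) := by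
  rw [pairing, Complex.ofReal_sum]
  refine Finset.sum_congr rfl fun e _ => ?_
  rw [← intervalIntegral.integral_ofReal]
  refine intervalIntegral.integral_congr fun x _ => ?_
  have h : initData (fun i => conj (p i)) e
      = (conj (initData p e).1, conj (initData p e).2) := rfl
  simp only [solOf, h, odeFlow_conj, Complex.mul_conj, Complex.normSq_eq_norm_sq]

open ComplexConjugate in
/-- The pairing of a continuous solution with its conjugate is definite. -/
lemma IsContData.eq_zero_of_pairing {mu : ℂ} {p : G.V ⊕ G.E → ℂ} (hp : IsContData mu p)
    (h : pairing mu (conj mu) p (fun i => conj (p i)) = 0) : p = 0 := by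
  rw [pairing_conj, Complex.ofReal_eq_zero, Finset.sum_eq_zero_iff_of_nonneg
    fun e _ => intervalIntegral.integral_nonneg (G.L_pos e).le fun x _ => by positivity] at h
  have hz : ∀ e, initData p e = 0 := by
    intro e
    have he := h e (Finset.mem_univ e)
    have hf : ∀ x ∈ Icc 0 (G.L e), solOf mu p e x = 0 := by
      by_contra! hne
      obtain ⟨x, hx, hx0⟩ := hne
      have := intervalIntegral.integral_pos (f := fun x => ‖solOf mu p e x‖ ^ 2) (G.L_pos e)
        ((continuous_solOf mu p e).norm.pow 2).continuousOn
        (fun x _ => sq_nonneg _) ⟨x, hx, pow_pos (norm_pos_iff.2 hx0) 2⟩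
      exact this.ne' he
    have h1 : p (.inl (G.o e)) = 0 := by
      rw [← solOf_zero mu p e]
      exact hf 0 ⟨le_rfl, (G.L_pos e).le⟩
    have h2 : p (.inr e) = 0 := by
      have hd : HasDerivWithinAt (solOf mu p e) (p (.inr e)) (Icc 0 (G.L e)) 0 := by
        have := hasDerivAt_odeFlow_fst mu (initData p e) 0
        rw [odeFlow_zero] at this
        exact this.hasDerivWithinAt
      have h0 : HasDerivWithinAt (solOf mu p e) 0 (Icc 0 (G.L e)) 0 :=
        (hasDerivWithinAt_const (0 : ℝ) (Icc 0 (G.L e)) (0 : ℂ)).congr hf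
          (hf 0 ⟨le_rfl, (G.L_pos e).le⟩)
      exact (uniqueDiffOn_Icc (G.L_pos e) 0 ⟨le_rfl, (G.L_pos e).le⟩).eq_deriv _ hd h0
    exact Prod.ext h1 h2
  ext (v | e)
  · obtain ⟨e, rfl | rfl⟩ := G.noIsolated v
    · exact congrArg Prod.fst (hz e)
    · rw [← hp.solOf_length, solOf, hz e, map_zero]
      rfl
  · exact congrArg Prod.snd (hz e)

/-- There are no eigenvalues off the real axis. -/
lemma eq_zero_of_vertexSystem {mu : ℂ} (hmu : mu.im ≠ 0) {p : G.V ⊕ G.E → ℂ}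
    (hp : G.vertexSystem mu p = 0) : p = 0 := by
  have hc : IsContData mu p := fun e => congrFun hp _
  have hp' := vertexSystem_conj mu p
  have hc' : IsContData (starRingEnd ℂ mu) (fun i => starRingEnd ℂ (p i)) := fun e => by
    rw [hp', hp]; simp
  have := green hc hc'
  rw [hp', hp] at this
  simp only [Pi.zero_apply, zero_mul, map_zero, mul_zero, sub_zero, Finset.sum_const_zero,
    mul_eq_zero] at this
  refine hc.eq_zero_of_pairing (this.resolve_left fun h => hmu ?_)
  exact Complex.conj_eq_iff_im.1 (sub_eq_zero.1 h)

end MetricGraph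

section MatrixPole

variable {m : Type}

lemma circleIntegral_eq_of_simple_pole {f g : ℂ → ℂ} {lam : ℂ} (hg : AnalyticAt ℂ g lam)
    (h : ∀ᶠ z in 𝓝[≠] lam, (z - lam) * f z = g z) :
    ∀ᶠ R in 𝓝[>] (0 : ℝ),
      (2 * (π : ℂ) * Complex.I)⁻¹ * circleIntegral f lam R = g lam := by
  obtain ⟨r₁, hr₁, h₁⟩ := Metric.eventually_nhds_iff.1 (eventually_nhdsWithin_iff.1 h)
  obtain ⟨r₂, hr₂, h₂⟩ := Metric.eventually_nhds_iff.1 hg.eventually_analyticAt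
  filter_upwards [Ioo_mem_nhdsGT (lt_min hr₁ hr₂)] with R hR
  have hd : DiffContOnCl ℂ g (Metric.ball lam R) := by
    refine DifferentiableOn.diffContOnCl fun z hz => ?_
    rw [closure_ball _ hR.1.ne'] at hz
    exact (h₂ ((Metric.mem_closedBall.1 hz).trans_lt
      (hR.2.trans_le (min_le_right _ _)))).differentiableAt.differentiableWithinAt
  have hi : circleIntegral f lam R = ∮ z in C(lam, R), (z - lam)⁻¹ • g z := by
    refine circleIntegral.integral_congr hR.1.le fun z hz => ?_
    have hz' : dist z lam = R := hz
    have hne : z ≠ lam := by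
      rintro rfl
      simp only [dist_self] at hz'
      exact hR.1.ne hz'
    rw [← h₁ (hz' ▸ hR.2.trans_le (min_le_left _ _)) hne, smul_eq_mul,
      inv_mul_cancel_left₀ (sub_ne_zero.2 hne)]
  rw [hi, hd.circleIntegral_sub_inv_smul (Metric.mem_ball_self hR.1), smul_eq_mul,
    inv_mul_cancel_left₀ (by simp [pi_ne_zero])]

lemma matResidue_eq_of_simple_pole {M : ℂ → Matrix m m ℂ} {g : m → m → ℂ → ℂ} {lam : ℂ}
    (hg : ∀ k l, AnalyticAt ℂ (g k l) lam)
    (h : ∀ k l, ∀ᶠ z in 𝓝[≠] lam, (z - lam) * M z k l = g k l z) :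
    matResidue M lam = Matrix.of fun k l => g k l lam := by
  ext k l
  have hc := circleIntegral_eq_of_simple_pole (hg k l) (h k l)
  have hex : ∃ c : ℂ, ∀ᶠ R in 𝓝[>] (0 : ℝ),
      (2 * (π : ℂ) * Complex.I)⁻¹ * circleIntegral (fun z => M z k l) lam R = c := ⟨_, hc⟩
  simp only [matResidue, Matrix.of_apply]
  rw [dif_pos hex]
  obtain ⟨R, h1, h2⟩ := (hex.choose_spec.and hc).exists
  exact h1.symm.trans h2

lemma isPole_iff_of_simple_pole [Finite m] {M : ℂ → Matrix m m ℂ} {g : m → m → ℂ → ℂ} {lam : ℂ}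
    (hg : ∀ k l, AnalyticAt ℂ (g k l) lam)
    (h : ∀ k l, ∀ᶠ z in 𝓝[≠] lam, (z - lam) * M z k l = g k l z) :
    isPole M lam ↔ (Matrix.of fun k l => g k l lam) ≠ 0 := by
  have hpow : ∀ n : ℕ, Tendsto (fun z => (z - lam) ^ (n + 1) • M z) (𝓝[≠] lam)
      (𝓝 ((0 : ℂ) ^ n • Matrix.of fun k l => g k l lam)) := by
    intro n
    refine tendsto_pi_nhds.2 fun k => tendsto_pi_nhds.2 fun l => ?_
    have hc : ContinuousAt (fun z => (z - lam) ^ n * g k l z) lam :=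
      (by fun_prop : ContinuousAt (fun z : ℂ => (z - lam) ^ n) lam).mul (hg k l).continuousAt
    have ht := hc.tendsto.mono_left (nhdsWithin_le_nhds (s := {lam}ᶜ))
    simp only [sub_self] at ht
    refine ht.congr' ?_
    filter_upwards [h k l] with z hz
    rw [← hz, Matrix.smul_apply, smul_eq_mul]
    ring
  constructor
  · rintro ⟨-, n, hn, ⟨A, hA, hlim⟩, -⟩ h0
    obtain ⟨n, rfl⟩ := Nat.exists_eq_add_of_le' hn
    have := tendsto_nhds_unique hlim (hpow n)
    rw [h0, smul_zero] at this
    exact hA this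
  · intro h0
    refine ⟨?_, 1, le_rfl, ⟨_, h0, by simpa using hpow 0⟩, by simpa using hpow 1⟩
    refine eventually_all.2 fun k => eventually_all.2 fun l => ?_
    have h1 : ∀ᶠ z in 𝓝[≠] lam, AnalyticAt ℂ (g k l) z :=
      (hg k l).eventually_analyticAt.filter_mono nhdsWithin_le_nhds
    have h2 := eventually_eventually_nhdsWithin.2 (h k l)
    filter_upwards [h1, h2, self_mem_nhdsWithin] with z hz1 hz2 hz
    have hz : z ≠ lam := hz
    have hsub : z - lam ≠ 0 := sub_ne_zero.2 hz
    have ha : AnalyticAt ℂ (fun w => (w - lam)⁻¹ * g k l w) z :=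
      ((analyticAt_id.sub analyticAt_const).inv hsub).mul hz1
    refine ha.congr ?_
    rw [IsOpen.nhdsWithin_eq isOpen_compl_singleton hz] at hz2
    filter_upwards [hz2, isOpen_compl_singleton.mem_nhds hz] with w hw hwne
    rw [← hw, inv_mul_cancel_left₀ (sub_ne_zero.2 hwne)]

lemma analyticAt_det {n : Type*} [Fintype n] [DecidableEq n] {A : ℂ → Matrix n n ℂ} {z : ℂ}
    (h : ∀ i j, AnalyticAt ℂ (fun w => A w i j) z) : AnalyticAt ℂ (fun w => (A w).det) z := by
  simp only [Matrix.det_apply']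
  exact Finset.analyticAt_fun_sum _ fun σ _ =>
    analyticAt_const.mul (Finset.analyticAt_fun_prod _ fun i _ => h _ _)

/-- A Gram type matrix over a spanning family has full rank. -/
lemma rank_eq_finrank_of_pairing [Fintype m] {K : Type*} [AddCommGroup K] [Module ℂ K]
    [FiniteDimensional ℂ K] (ρ : K →ₗ[ℂ] m → ℂ) (hρ : Function.Injective ρ) (g : m → K)
    (b : K →ₗ[ℂ] K →ₗ[ℂ] ℂ) (h : ∀ l q, -b (g l) q = ρ q l) :
    (Matrix.of fun k l => ρ (g l) k).rank = Module.finrank ℂ K := by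
  set W : Submodule ℂ K := Submodule.span ℂ (range g) with hW
  have hinj : Function.Injective (W.subtype.dualMap ∘ₗ b.flip) := by
    refine (injective_iff_map_eq_zero _).2 fun q hq => hρ ?_
    ext l
    have := LinearMap.congr_fun hq ⟨g l, Submodule.subset_span ⟨l, rfl⟩⟩
    have h' : b (g l) q = 0 := this
    rw [← h, h', map_zero, neg_zero, Pi.zero_apply]
  have hle := LinearMap.finrank_le_finrank_of_injective hinj
  rw [Subspace.dual_finrank_eq] at hle
  have htop : W = ⊤ := Submodule.eq_top_of_finrank_eq (le_antisymm W.finrank_le hle)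
  rw [Matrix.rank_eq_finrank_span_cols]
  have : range (Matrix.of fun k l => ρ (g l) k).col = ρ '' range g := by
    rw [← range_comp]
    rfl
  rw [this, Submodule.span_image, ← hW, htop, Submodule.map_top,
    LinearMap.finrank_range_of_inj hρ]

end MatrixPole

namespace MetricGraph

variable {G : MetricGraph}

lemma analyticAt_odeFlow_apply (x : ℝ) (v : ℂ × ℂ) (mu : ℂ) :
    AnalyticAt ℂ (fun z => odeFlow z x v) mu :=
  ((ContinuousLinearMap.apply ℂ (ℂ × ℂ) v).analyticAt _).comp (analyticAt_odeFlow x mu)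

lemma analyticAt_vertexSystem (p : G.V ⊕ G.E → ℂ) (i : G.V ⊕ G.E) (mu : ℂ) :
    AnalyticAt ℂ (fun z => G.vertexSystem z p i) mu := by
  have h1 : ∀ e, AnalyticAt ℂ (fun z => (odeFlow z (G.L e) (initData p e)).1) mu := fun e =>
    ((ContinuousLinearMap.fst ℂ ℂ ℂ).analyticAt _).comp (analyticAt_odeFlow_apply _ _ mu)
  have h2 : ∀ e, AnalyticAt ℂ (fun z => (odeFlow z (G.L e) (initData p e)).2) mu := fun e =>
    ((ContinuousLinearMap.snd ℂ ℂ ℂ).analyticAt _).comp (analyticAt_odeFlow_apply _ _ mu)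
  rcases i with v | e
  · simp only [vertexSystem_inl]
    exact (Finset.analyticAt_fun_sum _ fun e _ => h2 e).sub analyticAt_const
  · simp only [vertexSystem_inr]
    exact (h1 e).sub analyticAt_const

lemma continuous_solOf_joint (e : G.E) :
    Continuous fun a : (ℂ × (G.V ⊕ G.E → ℂ)) × ℝ => odeFlow a.1.1 a.2 (initData a.1.2 e) := by
  have h1 : Continuous fun a : (ℂ × (G.V ⊕ G.E → ℂ)) × ℝ => odeFlow a.1.1 a.2 :=
    continuous_odeFlow.comp (by fun_prop : Continuous fun a : (ℂ × (G.V ⊕ G.E → ℂ)) × ℝ =>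
      (a.1.1, a.2))
  refine h1.clm_apply ?_
  simp only [initData]
  fun_prop

lemma continuous_vertexSystem :
    Continuous fun a : ℂ × (G.V ⊕ G.E → ℂ) => G.vertexSystem a.1 a.2 := by
  have h : ∀ e, Continuous fun a : ℂ × (G.V ⊕ G.E → ℂ) =>
      odeFlow a.1 (G.L e) (initData a.2 e) := fun e =>
    (continuous_solOf_joint e).comp (by fun_prop : Continuous fun a : ℂ × (G.V ⊕ G.E → ℂ) =>
      (a, G.L e))
  refine continuous_pi fun i => ?_
  rcases i with v | e
  · simp only [vertexSystem_inl]
    exact (continuous_finsetSum _ fun e _ => (h e).snd).sub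
      (continuous_finsetSum _ fun e _ => by fun_prop)
  · simp only [vertexSystem_inr]
    exact (h e).fst.sub (by fun_prop)

lemma continuous_pairing (nu : ℂ) (q : G.V ⊕ G.E → ℂ) :
    Continuous fun a : ℂ × (G.V ⊕ G.E → ℂ) => pairing a.1 nu a.2 q := by
  refine continuous_finsetSum _ fun e _ => ?_
  refine intervalIntegral.continuous_parametric_intervalIntegral_of_continuous' ?_ _ _
  exact (continuous_solOf_joint e).fst.mul ((continuous_solOf nu q e).comp continuous_snd)

/-- The matrix of the vertex system. -/
def systemMatrix (G : MetricGraph) (mu : ℂ) : Matrix (G.V ⊕ G.E) (G.V ⊕ G.E) ℂ :=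
  LinearMap.toMatrix' (G.vertexSystem mu)

lemma systemMatrix_mulVec (mu : ℂ) (p : G.V ⊕ G.E → ℂ) :
    (G.systemMatrix mu).mulVec p = G.vertexSystem mu p :=
  LinearMap.toMatrix'_mulVec _ _

lemma analyticAt_systemMatrix (i j : G.V ⊕ G.E) (mu : ℂ) :
    AnalyticAt ℂ (fun z => G.systemMatrix z i j) mu := by
  simp only [systemMatrix, LinearMap.toMatrix'_apply]
  exact analyticAt_vertexSystem _ i mu

lemma det_systemMatrix_ne_zero {mu : ℂ} (hmu : mu.im ≠ 0) : (G.systemMatrix mu).det ≠ 0 := by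
  intro h
  obtain ⟨p, hp, h0⟩ := Matrix.exists_mulVec_eq_zero_iff.2 h
  exact hp (eq_zero_of_vertexSystem hmu (by rwa [systemMatrix_mulVec] at h0))

lemma eventually_det_ne_zero (lam : ℂ) :
    ∀ᶠ z in 𝓝[≠] lam, (G.systemMatrix z).det ≠ 0 := by
  by_contra h
  have h' : ∃ᶠ z in 𝓝[≠] lam, (G.systemMatrix z).det = 0 := by
    exact fun h0 => h h0
  have := AnalyticOnNhd.eqOn_zero_of_preconnected_of_frequently_eq_zero (U := univ)
    (fun z _ => analyticAt_det fun i j => G.analyticAt_systemMatrix i j z)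
    isPreconnected_univ (mem_univ lam) h'
  exact det_systemMatrix_ne_zero (mu := Complex.I) (by simp) (this (mem_univ Complex.I))

/-- The data of the function `f^{(v)}` defining the Titchmarsh--Weyl matrix. -/
def twData (v : G.V) (mu : ℂ) : G.V ⊕ G.E → ℂ :=
  (G.systemMatrix mu)⁻¹.mulVec (Pi.single (.inl v) 1)

lemma vertexSystem_eq_iff {mu : ℂ} (h : (G.systemMatrix mu).det ≠ 0) {v : G.V}
    {p : G.V ⊕ G.E → ℂ} : G.vertexSystem mu p = Pi.single (.inl v) 1 ↔ p = twData v mu := by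
  have hu : IsUnit (G.systemMatrix mu).det := h.isUnit
  rw [← systemMatrix_mulVec, twData]
  constructor
  · intro h
    rw [← h, Matrix.mulVec_mulVec, Matrix.nonsing_inv_mul _ hu, Matrix.one_mulVec]
  · rintro rfl
    rw [Matrix.mulVec_mulVec, Matrix.mul_nonsing_inv _ hu, Matrix.one_mulVec]

lemma TW_eq_twData {mu : ℂ} (h : (G.systemMatrix mu).det ≠ 0) (B : Finset G.V) (k l : B) :
    G.TW B mu k l = twData (l : G.V) mu (.inl (k : G.V)) := by
  have hex : ∃ f, G.IsTWsol mu l f :=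
    ⟨_, isTWsol_iff.2 ⟨_, (vertexSystem_eq_iff h).2 rfl, rfl⟩⟩
  simp only [TW, Matrix.of_apply]
  rw [dif_pos hex]
  obtain ⟨p, hp, hf⟩ := isTWsol_iff.1 hex.choose_spec
  have hc : IsContData mu p := fun e => by rw [hp, Pi.single_eq_of_ne (by simp)]
  rw [hf, hc.vtxVal_solOf, (vertexSystem_eq_iff h).1 hp]

lemma meromorphicAt_twData (v : G.V) (lam : ℂ) : MeromorphicAt (twData v) lam := by
  have h : twData v = fun z => ((G.systemMatrix z).det)⁻¹ •
      (G.systemMatrix z).adjugate.mulVec (Pi.single (.inl v) 1) := by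
    funext z
    rw [twData, Matrix.inv_def, Ring.inverse_eq_inv', Matrix.smul_mulVec]
  rw [h]
  refine (analyticAt_det fun i j => G.analyticAt_systemMatrix i j lam).meromorphicAt.inv.smul
    (AnalyticAt.meromorphicAt (analyticAt_pi_iff.2 fun i => ?_))
  simp only [Matrix.mulVec_single_one, Matrix.col_apply, Matrix.adjugate_apply]
  refine analyticAt_det fun a b => ?_
  simp only [Matrix.updateRow_apply]
  split_ifs
  · exact analyticAt_const
  · exact G.analyticAt_systemMatrix a b lam

/-- The leading coefficients of `f^{(v)}` at `λ` lie in the kernel and are controlled by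
Green's identity. -/
lemma leading_coeff_twData {lam : ℂ} {v : G.V} {n : ℕ} {g : ℂ → G.V ⊕ G.E → ℂ}
    (hg : ContinuousAt g lam)
    (h : ∀ᶠ z in 𝓝[≠] lam, (z - lam) ^ (n + 1) • twData v z = g z) :
    G.vertexSystem lam (g lam) = 0 ∧ ∀ q, G.vertexSystem lam q = 0 →
      -pairing lam lam (g lam) q = 0 ^ n * q (.inl v) := by
  have hsys : ∀ᶠ z in 𝓝[≠] lam,
      G.vertexSystem z (g z) = (z - lam) ^ (n + 1) • Pi.single (.inl v) 1 := by
    filter_upwards [h, eventually_det_ne_zero lam] with z hz hdet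
    rw [← hz, map_smul, (vertexSystem_eq_iff hdet).2 rfl]
  have hpair : Tendsto (fun z => (z, g z)) (𝓝[≠] lam) (𝓝 (lam, g lam)) :=
    (continuousAt_id.prodMk hg).tendsto.mono_left nhdsWithin_le_nhds
  have hpow : ∀ m : ℕ, Tendsto (fun z => (z - lam) ^ m) (𝓝[≠] lam) (𝓝 (0 ^ m)) := fun m => by
    have : ContinuousAt (fun z : ℂ => (z - lam) ^ m) lam := by fun_prop
    simpa using this.tendsto.mono_left (nhdsWithin_le_nhds (s := {lam}ᶜ))
  constructor
  · have h1 := (continuous_vertexSystem (G := G)).continuousAt.tendsto.comp hpair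
    have h2 := (hpow (n + 1)).smul_const (Pi.single (.inl v) 1 : G.V ⊕ G.E → ℂ)
    rw [pow_succ, mul_zero, zero_smul] at h2
    exact tendsto_nhds_unique_of_eventuallyEq h1 h2 hsys
  · intro q hq
    have h1 := ((continuous_pairing lam q).continuousAt.tendsto.comp hpair).neg
    have h2 := (hpow n).mul_const (q (.inl v))
    refine tendsto_nhds_unique_of_eventuallyEq h1 h2 ?_
    filter_upwards [hsys, self_mem_nhdsWithin] with z hz hne
    have hsub : z - lam ≠ 0 := sub_ne_zero.2 hne
    have hc : IsContData z (g z) := fun e => by rw [hz]; simp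
    have hcq : IsContData lam q := fun e => congrFun hq _
    have := green hc hcq
    rw [hz, hq] at this
    simp only [Pi.smul_apply, smul_eq_mul, Pi.single_apply, Sum.inl.injEq, Pi.zero_apply,
      mul_zero, sub_zero, mul_ite, mul_one, ite_mul, zero_mul, Finset.sum_ite_eq',
      Finset.mem_univ, if_true] at this
    refine mul_left_cancel₀ hsub ?_
    simp only [Function.comp_apply]
    linear_combination this

/-- The poles of `f^{(v)}` on the real axis are simple. -/
lemma exists_analyticAt_twData (v : G.V) (lam : ℝ) :
    ∃ g : ℂ → G.V ⊕ G.E → ℂ, AnalyticAt ℂ g lam ∧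
      ∀ᶠ z : ℂ in 𝓝[≠] (lam : ℂ), (z - lam) • twData v z = g z := by
  have hm := meromorphicAt_twData v (lam : ℂ)
  rcases eq_or_ne (meromorphicOrderAt (twData v) (lam : ℂ)) ⊤ with htop | htop
  · refine ⟨0, analyticAt_const, ?_⟩
    filter_upwards [meromorphicOrderAt_eq_top_iff.1 htop] with z hz
    simp [hz]
  obtain ⟨n, hn⟩ := WithTop.ne_top_iff_exists.1 htop
  obtain ⟨g, hg, hg0, hgz⟩ := (meromorphicOrderAt_eq_int_iff hm).1 hn.symm
  rcases le_or_gt (-1) n with hle | hlt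
  · obtain ⟨m, hm⟩ := Int.eq_ofNat_of_zero_le (show 0 ≤ n + 1 by omega)
    refine ⟨fun z => (z - lam) ^ m • g z,
      ((analyticAt_id.sub analyticAt_const).pow m).smul hg, ?_⟩
    filter_upwards [hgz, self_mem_nhdsWithin] with z hz hne
    have hsub : z - lam ≠ 0 := sub_ne_zero.2 hne
    rw [hz, smul_smul, ← zpow_one_add₀ hsub, add_comm, hm, zpow_natCast]
  · obtain ⟨m, hm⟩ := Int.eq_ofNat_of_zero_le (show 0 ≤ -n - 2 by omega)
    have hpole : ∀ᶠ z : ℂ in 𝓝[≠] (lam : ℂ), (z - lam) ^ (m + 1 + 1) • twData v z = g z := by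
      filter_upwards [hgz, self_mem_nhdsWithin] with z hz hne
      have hsub : z - lam ≠ 0 := sub_ne_zero.2 hne
      have : n = -((m + 1 + 1 : ℕ) : ℤ) := by push_cast; omega
      rw [hz, this, zpow_neg, zpow_natCast, smul_inv_smul₀ (pow_ne_zero _ hsub)]
    obtain ⟨hker, hgreen⟩ := leading_coeff_twData hg.continuousAt hpole
    refine absurd ?_ hg0
    have hc : IsContData (lam : ℂ) (g lam) := fun e => congrFun hker _
    have hconj : G.vertexSystem lam (fun i => starRingEnd ℂ (g lam i)) = 0 := by
      have := vertexSystem_conj (lam : ℂ) (g lam)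
      rw [Complex.conj_ofReal, hker] at this
      rw [this]
      ext i
      simp
    refine hc.eq_zero_of_pairing ?_
    rw [Complex.conj_ofReal]
    have := hgreen _ hconj
    rwa [pow_succ, mul_zero, zero_mul, neg_eq_zero] at this

/-- The pairing on edgewise solutions as a bilinear map. -/
def pairingLin (G : MetricGraph) (mu : ℂ) :
    (G.V ⊕ G.E → ℂ) →ₗ[ℂ] (G.V ⊕ G.E → ℂ) →ₗ[ℂ] ℂ :=
  have hi : ∀ (p q : G.V ⊕ G.E → ℂ) (e : G.E), IntervalIntegrable
      (fun x => solOf mu p e x * solOf mu q e x) MeasureTheory.volume 0 (G.L e) := fun p q e =>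
    ((continuous_solOf mu p e).mul (continuous_solOf mu q e)).intervalIntegrable _ _
  LinearMap.mk₂ ℂ (pairing mu mu)
    (fun p p' q => by
      simp only [pairing, ← Finset.sum_add_distrib]
      refine Finset.sum_congr rfl fun e _ => ?_
      rw [← intervalIntegral.integral_add (hi p q e) (hi p' q e)]
      simp [solOf, initData_add, add_mul])
    (fun c p q => by
      simp only [pairing, smul_eq_mul, Finset.mul_sum, ← intervalIntegral.integral_const_mul]
      simp [solOf, initData_smul, mul_assoc])
    (fun p q q' => by
      simp only [pairing, ← Finset.sum_add_distrib]
      refine Finset.sum_congr rfl fun e _ => ?_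
      rw [← intervalIntegral.integral_add (hi p q e) (hi p q' e)]
      simp [solOf, initData_add, mul_add])
    (fun c p q => by
      simp only [pairing, smul_eq_mul, Finset.mul_sum, ← intervalIntegral.integral_const_mul]
      simp [solOf, initData_smul, mul_left_comm])

/-- If functions in the kernel are determined by their values on `B`, then `M_B` detects the
eigenvalue `λ` together with its multiplicity. -/
lemma pole_and_rank_of_injective (B : Finset G.V) (lam : ℝ)
    (hB : ∀ p, G.vertexSystem lam p = 0 → (∀ v ∈ B, p (.inl v) = 0) → p = 0) :
    (G.IsEigenvalue lam ↔ isPole (G.TW B) (lam : ℂ)) ∧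
    G.dimKer lam = (matResidue (G.TW B) (lam : ℂ)).rank := by
  choose g hg hgz using fun v => exists_analyticAt_twData v lam
  have han : ∀ k l : B, AnalyticAt ℂ (fun z => g l z (.inl (k : G.V))) lam := fun k l =>
    analyticAt_pi_iff.1 (hg l) _
  have hTW : ∀ k l : B, ∀ᶠ z : ℂ in 𝓝[≠] (lam : ℂ),
      (z - lam) * G.TW B z k l = g l z (.inl (k : G.V)) := fun k l => by
    filter_upwards [hgz l, eventually_det_ne_zero (G := G) lam] with z hz hdet
    rw [TW_eq_twData hdet, ← hz, Pi.smul_apply, smul_eq_mul]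
  have hlead : ∀ v, G.vertexSystem lam (g v lam) = 0 ∧ ∀ q, G.vertexSystem lam q = 0 →
      -pairing lam lam (g v lam) q = 0 ^ 0 * q (.inl v) := fun v =>
    leading_coeff_twData (hg v).continuousAt (by simpa using hgz v)
  let K := LinearMap.ker (G.vertexSystem lam)
  let ρ : K →ₗ[ℂ] B → ℂ := LinearMap.funLeft ℂ ℂ (fun k : B => Sum.inl (k : G.V)) ∘ₗ K.subtype
  have hρ : Function.Injective ρ := by
    refine (injective_iff_map_eq_zero _).2 fun p hp => ?_
    exact Subtype.ext (hB p p.2 fun v hv => congrFun hp ⟨v, hv⟩)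
  have hrank := rank_eq_finrank_of_pairing ρ hρ (fun l => ⟨g l lam, (hlead l).1⟩)
    ((G.pairingLin lam).compl₁₂ K.subtype K.subtype) fun l q =>
      ((hlead l).2 q q.2).trans (by rw [pow_zero, one_mul]; rfl)
  have hdim : G.dimKer lam = (matResidue (G.TW B) (lam : ℂ)).rank := by
    rw [dimKer_eq, matResidue_eq_of_simple_pole han hTW]
    exact hrank.symm
  refine ⟨?_, hdim⟩
  rw [isEigenvalue_iff, hdim, isPole_iff_of_simple_pole han hTW,
    matResidue_eq_of_simple_pole han hTW, not_iff_not, Matrix.rank_eq_finrank_span_cols,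
    Submodule.finrank_eq_zero, Submodule.span_eq_bot]
  constructor
  · intro h
    ext k l
    exact congrFun (h _ ⟨l, rfl⟩) k
  · rintro h _ ⟨l, rfl⟩
    ext k
    exact congrFun (congrFun h k) l

end MetricGraph

namespace MetricGraph

variable {G : MetricGraph}

/-- If an edge `e` of `S` traversed in direction `d` does not end at a vertex of degree one in
`S`, then it can be continued inside `S` without backtracking. -/
lemma exists_next_dart {S : Set G.E} (hS : ∀ v, G.degreeIn S v ≠ 1) (x : G.E × Bool)
    (hx : x.1 ∈ S) :
    ∃ y : G.E × Bool, y.1 ∈ S ∧ G.esrc y.1 y.2 = G.edst x.1 x.2 ∧ y ≠ (x.1, !x.2) := by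
  by_contra! h
  obtain ⟨e, d⟩ := x
  have ho : ∀ e' ∈ S, G.o e' = G.edst e d → (e', true) = (e, !d) := fun e' he' h' =>
    h (e', true) he' h'
  have ht : ∀ e' ∈ S, G.t e' = G.edst e d → (e', false) = (e, !d) := fun e' he' h' =>
    h (e', false) he' h'
  refine hS (G.edst e d) ?_
  cases d
  · have h1 : {e' | e' ∈ S ∧ G.o e' = G.edst e false} = {e} := by
      ext e'
      constructor
      · rintro ⟨h1, h2⟩
        simpa using ho e' h1 h2
      · rintro rfl
        exact ⟨hx, rfl⟩
    have h2 : {e' | e' ∈ S ∧ G.t e' = G.edst e false} = ∅ := by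
      ext e'
      simp only [mem_empty_iff_false, iff_false]
      rintro ⟨h1, h2⟩
      simpa using ht e' h1 h2
    rw [degreeIn, h1, h2]
    simp
  · have h1 : {e' | e' ∈ S ∧ G.t e' = G.edst e true} = {e} := by
      ext e'
      constructor
      · rintro ⟨h1, h2⟩
        simpa using ht e' h1 h2
      · rintro rfl
        exact ⟨hx, rfl⟩
    have h2 : {e' | e' ∈ S ∧ G.o e' = G.edst e true} = ∅ := by
      ext e'
      simp only [mem_empty_iff_false, iff_false]
      rintro ⟨h1, h2⟩
      simpa using ho e' h1 h2
    rw [degreeIn, h1, h2]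
    simp

lemma esrc_not (e : G.E) (d : Bool) : G.esrc e (!d) = G.edst e d := by
  cases d <;> rfl

/-- A nonempty subgraph without vertices of degree one contains a cycle. -/
lemma exists_cycle_inSub {S : Set G.E} (hS : ∀ v, G.degreeIn S v ≠ 1) (hne : S.Nonempty) :
    ∃ c : G.Cycle, c.inSub S := by
  obtain ⟨e₀, he₀⟩ := hne
  choose! next hnS hnsrc hnback using exists_next_dart hS
  let x : ℕ → G.E × Bool := fun n => next^[n] (e₀, true)
  have hsucc : ∀ n, x (n + 1) = next (x n) := fun n => Function.iterate_succ_apply' _ _ _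
  have hxS : ∀ n, (x n).1 ∈ S := by
    intro n
    induction n with
    | zero => exact he₀
    | succ n ih => rw [hsucc]; exact hnS _ ih
  have hsrc : ∀ n, G.esrc (x (n + 1)).1 (x (n + 1)).2 = G.edst (x n).1 (x n).2 := fun n => by
    rw [hsucc]; exact hnsrc _ (hxS n)
  have hback : ∀ n, x (n + 1) ≠ ((x n).1, !(x n).2) := fun n => by
    rw [hsucc]; exact hnback _ (hxS n)
  let w : ℕ → G.V := fun n => G.esrc (x n).1 (x n).2
  have hex : ∃ n, 0 < n ∧ ∃ i, w i = w (i + n) := by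
    obtain ⟨i, j, hij, h⟩ := Finite.exists_ne_map_eq_of_infinite w
    rcases lt_or_gt_of_ne hij with hlt | hlt
    · exact ⟨j - i, by omega, i, by rw [h]; congr; omega⟩
    · exact ⟨i - j, by omega, j, by rw [← h]; congr; omega⟩
  classical
  obtain ⟨hn, i, hi⟩ := Nat.find_spec hex
  have hmin : ∀ a b, a < b → b < Nat.find hex → w (i + a) ≠ w (i + b) := by
    intro a b hab hb h
    refine Nat.find_min hex (m := b - a) (by omega) ⟨by omega, i + a, ?_⟩
    rw [h]
    congr 1
    omega
  set n := Nat.find hex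
  have hinj : ∀ a b, a < n → b < n → w (i + a) = w (i + b) → a = b := by
    intro a b ha hb h
    rcases lt_trichotomy a b with h' | h' | h'
    · exact absurd h (hmin a b h' hb)
    · exact h'
    · exact absurd h.symm (hmin b a h' ha)
  have hedge : ∀ a b, a < b → b < n → (x (i + a)).1 ≠ (x (i + b)).1 := by
    intro a b hab hb h
    by_cases hd : (x (i + a)).2 = (x (i + b)).2
    · exact hmin a b hab hb (by simp only [w, h, hd])
    · have hd' : (x (i + b)).2 = !(x (i + a)).2 := by
        cases h1 : (x (i + a)).2 <;> cases h2 : (x (i + b)).2 <;> simp_all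
      have h1 : w (i + (a + 1)) = w (i + b) := by
        simp only [w]
        rw [← add_assoc, hsrc, ← h, hd', esrc_not]
      have h2 := hinj (a + 1) b (by omega) hb h1
      subst h2
      exact hback (i + a) (Prod.ext h.symm hd')
  refine ⟨⟨n, hn, fun a => (x (i + a)).1, fun a => (x (i + a)).2, ?_, ?_, ?_⟩,
    fun a => hxS _⟩
  · intro a b h
    rcases lt_trichotomy a b with h' | h' | h'
    · exact absurd h (hedge a b h' b.2)
    · exact h'
    · exact absurd h.symm (hedge b a h' a.2)
  · exact fun a b h => Fin.ext (hinj a b a.2 b.2 h)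
  · intro a
    simp only
    rw [← hsrc]
    rcases Nat.lt_or_ge (a + 1) n with h | h
    · simp only [Nat.mod_eq_of_lt h, add_assoc]
    · have : (a : ℕ) + 1 = n := by omega
      simp only [this, Nat.mod_self, add_zero, add_assoc]
      exact hi.symm

/-- A cycle whose edge lengths are multiples of `π / √λ` bounds the threshold by `λ`. -/
lemma lamThreshold_le_of_cycle {lam : ℝ} (hlam : 0 < lam) (c : G.Cycle)
    (h : ∀ i, ∃ k : ℕ, 0 < k ∧ G.L (c.edge i) = k * (π / √lam)) :
    G.lamThreshold ≤ (lam : EReal) := by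
  have hu : 0 < π / √lam := by positivity
  have hcomm : G.Commensurate c := by
    intro i j
    obtain ⟨k, -, hk⟩ := h i
    obtain ⟨l, hl, hl'⟩ := h j
    refine ⟨(k : ℚ) / l, ?_⟩
    have : (l : ℝ) ≠ 0 := by positivity
    rw [hk, hl']
    push_cast
    field_simp
  have hle : π / √lam ≤ G.uC c := by
    refine le_csSup ⟨G.L (c.edge ⟨0, c.npos⟩), ?_⟩ ⟨hu, h⟩
    rintro u ⟨hu, hk⟩
    obtain ⟨k, hk, hk'⟩ := hk ⟨0, c.npos⟩
    rw [hk']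
    exact le_mul_of_one_le_left hu.le (by exact_mod_cast hk)
  have hmem : ((π ^ 2 / (G.uC c) ^ 2 : ℝ) : EReal) ∈
      {x : EReal | ∃ c : G.Cycle, G.Commensurate c ∧
        x = ((π ^ 2 / (G.uC c) ^ 2 : ℝ) : EReal)} := ⟨c, hcomm, rfl⟩
  refine (sInf_le hmem).trans (EReal.coe_le_coe_iff.2 ?_)
  calc π ^ 2 / G.uC c ^ 2 ≤ π ^ 2 / (π / √lam) ^ 2 := by gcongr
    _ = lam := by
      rw [div_pow, Real.sq_sqrt hlam.le]
      field_simp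

/-- If `p` vanishes at `v` and `v` has degree one in the support of `p`, the normal derivative
of the solution at `v` does not vanish. -/
lemma degreeIn_support_ne_one {mu : ℂ} {p : G.V ⊕ G.E → ℂ} (hp : G.vertexSystem mu p = 0)
    {v : G.V} (hv : p (.inl v) = 0) : G.degreeIn {e | initData p e ≠ 0} v ≠ 1 := by
  intro hdeg
  have hker := congrFun hp (.inl v)
  have hout : ∀ e, ¬ initData p e ≠ 0 → p (.inr e) = 0 ∧
      (odeFlow mu (G.L e) (initData p e)).2 = 0 := fun e he => by
    rw [not_not] at he
    exact ⟨congrArg Prod.snd he, by rw [he, map_zero]; rfl⟩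
  rw [vertexSystem_inl, Pi.zero_apply] at hker
  rcases Nat.add_eq_one_iff.1 hdeg with ⟨h0, h1⟩ | ⟨h1, h0⟩
  all_goals
    rw [ncard_eq_zero, eq_empty_iff_forall_notMem] at h0
    obtain ⟨e, he⟩ := ncard_eq_one.1 h1
    obtain ⟨heS, hev⟩ : initData p e ≠ 0 ∧ _ := he ▸ mem_singleton e
  · have huniq : ∀ e', G.t e' = v → e' ≠ e → ¬ initData p e' ≠ 0 := fun e' h' hne hS => by
      have hmem : e' ∈ {e | e ∈ {e | initData p e ≠ 0} ∧ G.t e = v} := ⟨hS, h'⟩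
      rw [he, mem_singleton_iff] at hmem
      exact hne hmem
    rw [Finset.sum_eq_single e (fun e' h' hne =>
        (hout e' (huniq e' (Finset.mem_filter.1 h').2 hne)).2)
        (fun h' => (h' (Finset.mem_filter.2 ⟨Finset.mem_univ _, hev⟩)).elim),
      Finset.sum_eq_zero (fun e' h' => (hout e' fun hS =>
        h0 e' ⟨hS, (Finset.mem_filter.1 h').2⟩).1), sub_zero] at hker
    have hval : (odeFlow mu (G.L e) (initData p e)).1 = 0 := by
      have := congrFun hp (.inr e)
      rwa [vertexSystem_inr, hev, hv, sub_zero] at this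
    exact heS (odeFlow_injective (Prod.ext hval hker))
  · have huniq : ∀ e', G.o e' = v → e' ≠ e → ¬ initData p e' ≠ 0 := fun e' h' hne hS => by
      have hmem : e' ∈ {e | e ∈ {e | initData p e ≠ 0} ∧ G.o e = v} := ⟨hS, h'⟩
      rw [he, mem_singleton_iff] at hmem
      exact hne hmem
    rw [Finset.sum_eq_single (s := Finset.univ.filter fun e => G.o e = v) e (fun e' h' hne =>
        (hout e' (huniq e' (Finset.mem_filter.1 h').2 hne)).1)
        (fun h' => (h' (Finset.mem_filter.2 ⟨Finset.mem_univ _, hev⟩)).elim),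
      Finset.sum_eq_zero (fun e' h' => (hout e' fun hS =>
        h0 e' ⟨hS, (Finset.mem_filter.1 h').2⟩).2), zero_sub, neg_eq_zero] at hker
    refine heS (Prod.ext ?_ hker)
    change p (.inl (G.o e)) = 0
    rw [hev, hv]

/-- Below the threshold, a function in the kernel which vanishes at all boundary vertices and
all proper core vertices vanishes identically. -/
lemma eq_zero_of_vanish_on {B : Finset G.V} (hbd : ∀ v, G.IsBoundaryVertex v → v ∈ B)
    (hcore : ∀ v, G.IsProperCoreVertex v → v ∈ B) {lam : ℝ}
    (hlam : (lam : EReal) < G.lamThreshold) {p : G.V ⊕ G.E → ℂ}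
    (hp : G.vertexSystem lam p = 0) (hpB : ∀ v ∈ B, p (.inl v) = 0) : p = 0 := by
  set S : Set G.E := {e | initData p e ≠ 0} with hSdef
  have hc : IsContData (lam : ℂ) p := fun e => congrFun hp _
  have hnot : ∀ e v, e ∉ S → G.o e = v ∨ G.t e = v → p (.inl v) = 0 := by
    rintro e v he (rfl | rfl)
    · exact congrArg Prod.fst (not_not.1 he)
    · rw [← hc.solOf_length, solOf, not_not.1 he, map_zero]
      rfl
  have hdeg : ∀ v, G.degreeIn S v ≠ 1 := by
    intro v
    by_cases hv : p (.inl v) = 0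
    · exact degreeIn_support_ne_one hp hv
    · have hvS : ∀ e, G.o e = v ∨ G.t e = v → e ∈ S := fun e he => by
        by_contra h
        exact hv (hnot e v h he)
      have heq : G.degreeIn S v = G.degree v := by
        rw [degreeIn, degree]
        congr 2 <;> ext e
        · exact ⟨fun h => h.2, fun h => ⟨hvS e (.inl h), h⟩⟩
        · exact ⟨fun h => h.2, fun h => ⟨hvS e (.inr h), h⟩⟩
      rw [heq]
      exact fun h => hv (hpB v (hbd v h))
  have hvert : ∀ v, p (.inl v) = 0 := by
    intro v
    by_contra hv
    refine hv (hpB v (hcore v fun e he => ?_))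
    refine mem_sUnion.2 ⟨S, hdeg, ?_⟩
    by_contra h
    exact hv (hnot e v h he)
  have hedge : ∀ e ∈ S, 0 < lam ∧ ∃ k : ℕ, 0 < k ∧ G.L e = k * (π / √lam) := by
    intro e he
    have hdata : initData p e = (0, p (.inr e)) := Prod.ext (hvert _) rfl
    refine exists_nat_of_odeFlow_eq_zero (G.L_pos e) (b := p (.inr e)) (fun h0 => he ?_) ?_
    · rw [hdata, h0]
      rfl
    · rw [← hdata]
      exact (hc.solOf_length e).trans (hvert _)
  have hS : S = ∅ := by
    by_contra hne
    obtain ⟨c, hcS⟩ := exists_cycle_inSub hdeg (nonempty_iff_ne_empty.2 hne)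
    exact (lamThreshold_le_of_cycle (hedge _ (hcS ⟨0, c.npos⟩)).1 c
      fun i => (hedge _ (hcS i)).2).not_gt hlam
  ext (v | e)
  · exact hvert v
  · have : e ∉ S := by simp [hS]
    exact congrArg Prod.snd (not_not.1 this)

end MetricGraph

/-- final Corollary: if `B` contains all boundary vertices and all
proper core vertices and `λ < λ_G`, then `λ` is an eigenvalue of `-Δ_G` iff `λ` is a
pole of `M_B`, and `dim ker(-Δ_G - λ) = rank Res_λ M_B`. -/
theorem statement_15 (G : MetricGraph) (B : Finset G.V)
    (hbd : ∀ v, G.IsBoundaryVertex v → v ∈ B)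
    (hcore : ∀ v, G.IsProperCoreVertex v → v ∈ B)
    (lam : ℝ) (hlam : (lam : EReal) < G.lamThreshold) :
    (G.IsEigenvalue lam ↔ isPole (G.TW B) (lam : ℂ)) ∧
    G.dimKer lam = (matResidue (G.TW B) (lam : ℂ)).rank := by
  exact MetricGraph.pole_and_rank_of_injective B lam fun p hp hpB =>
    MetricGraph.eq_zero_of_vanish_on hbd hcore hlam hp hpB
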